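/- In the limit z → 0 the su_q^P(3) bracket recovers the Lie–Poisson bracket of su(3): for every pair of coordinate functions u, v among (h₁,h₂,h₃,a₁₂,a₂₁,a₂₃,a₃₂,a₁₃,a₃₁) and every point p ∈ ℝ⁹, lim_{z→0} {u,v}_z(p) equals the corresponding undeformed value given by the su(3) structure constants; explicitly the nonzero limits are: {hᵢ,a_{jk}} = (δᵢⱼ−δᵢₖ)a_{jk}, {a₁₂,a₂₃}=a₁₃, {a₃₂,a₂₁}=a₃₁, {a₁₂,a₂₁}=h₁−h₂, {a₂₃,a₃₂}=h₂−h₃, {a₁₃,a₃₁}=h₁−h₃, {a₁₃,a₂₁}=−a₂₃, {a₁₃,a₃₂}=a₁₂, {a₁₂,a₃₁}=−a₃₂, {a₂₃,a₃₁}=a₂₁, while {a₁₂,a₁₃}, {a₁₃,a₂₃}, {a₃₁,a₂₁}, {a₃₂,a₃₁}, {a₂₃,a₂₁}, {a₁₂,a₃₂} all tend to 0. -/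

import Mathlib

open Filter Topology

/-- Partial derivative of a function on ℝ⁹ in the `i`-th coordinate direction.
Coordinates: (x 0,…,x 8) = (h₁,h₂,h₃,a₁₂,a₂₁,a₂₃,a₃₂,a₁₃,a₃₁). -/
noncomputable def pd (i : Fin 9) (f : (Fin 9 → ℝ) → ℝ) (x : Fin 9 → ℝ) : ℝ :=
  fderiv ℝ f x (Pi.single i 1)

/-- The structure functions π(u,v) of su_q^P(3) for u < v (zero otherwise);
indices: 0=h₁, 1=h₂, 2=h₃, 3=a₁₂, 4=a₂₁, 5=a₂₃, 6=a₃₂, 7=a₁₃, 8=a₃₁. -/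
noncomputable def piU (z : ℝ) (u v : ℕ) (x : Fin 9 → ℝ) : ℝ :=
  match u, v with
  | 0, 3 => x 3
  | 0, 4 => -x 4
  | 0, 7 => x 7
  | 0, 8 => -x 8
  | 1, 3 => -x 3
  | 1, 4 => x 4
  | 1, 5 => x 5
  | 1, 6 => -x 6
  | 2, 5 => -x 5
  | 2, 6 => x 6
  | 2, 7 => -x 7
  | 2, 8 => x 8
  | 3, 4 => Real.sinh (z * (x 0 - x 1)) / z
  | 3, 5 => x 7
  | 3, 7 => z ^ 2 * x 3 ^ 2 * x 5
  | 3, 8 => -(Real.cosh (z * (x 0 - x 1)) * x 6)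
  | 4, 6 => -x 8
  | 4, 7 => Real.cosh (z * (x 0 - x 1)) * x 5
  | 4, 8 => -(z ^ 2 * x 4 ^ 2 * x 6)
  | 5, 6 => Real.sinh (z * (x 1 - x 2)) / z
  | 5, 7 => -(z ^ 2 * x 5 ^ 2 * x 3)
  | 5, 8 => Real.cosh (z * (x 1 - x 2)) * x 4
  | 6, 7 => -(Real.cosh (z * (x 1 - x 2)) * x 3)
  | 6, 8 => z ^ 2 * x 6 ^ 2 * x 4
  | 7, 8 => Real.sinh (z * (x 0 - x 2)) / z
      + z * Real.sinh (z * (x 0 - x 1)) * x 5 * x 6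
      + z * Real.sinh (z * (x 1 - x 2)) * x 3 * x 4
  | _, _ => 0

/-- The bracket of the q-Poisson algebra su_q^P(3):
{f,g} = Σ_{u<v} π(u,v)(∂_u f ∂_v g − ∂_v f ∂_u g). -/
noncomputable def suq3Bracket (z : ℝ) (f g : (Fin 9 → ℝ) → ℝ) (x : Fin 9 → ℝ) : ℝ :=
  ∑ u : Fin 9, ∑ v : Fin 9,
    if u < v then piU z u.val v.val x * (pd u f x * pd v g x - pd v f x * pd u g x)
    else 0

/-- The undeformed su(3) Lie–Poisson structure functions for u < v
(zero otherwise); same index conventions as `piU`. -/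
noncomputable def lieU (u v : ℕ) (x : Fin 9 → ℝ) : ℝ :=
  match u, v with
  | 0, 3 => x 3
  | 0, 4 => -x 4
  | 0, 7 => x 7
  | 0, 8 => -x 8
  | 1, 3 => -x 3
  | 1, 4 => x 4
  | 1, 5 => x 5
  | 1, 6 => -x 6
  | 2, 5 => -x 5
  | 2, 6 => x 6
  | 2, 7 => -x 7
  | 2, 8 => x 8
  | 3, 4 => x 0 - x 1
  | 3, 5 => x 7
  | 3, 8 => -x 6
  | 4, 6 => -x 8
  | 4, 7 => x 5
  | 5, 6 => x 1 - x 2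
  | 5, 8 => x 4
  | 6, 7 => -x 3
  | 7, 8 => x 0 - x 2
  | _, _ => 0

/-- The antisymmetrized undeformed su(3) Lie–Poisson bracket of the coordinate
functions u and v, evaluated at x. -/
noncomputable def lieVal (u v : Fin 9) (x : Fin 9 → ℝ) : ℝ :=
  lieU u.val v.val x - lieU v.val u.val x

lemma pd_coord (i u : Fin 9) (x : Fin 9 → ℝ) :
    pd i (fun y => y u) x = if i = u then 1 else 0 := by
  have h : HasFDerivAt (fun y : Fin 9 → ℝ => y u)
      (ContinuousLinearMap.proj (R := ℝ) (φ := fun _ : Fin 9 => ℝ) u) x :=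
    (ContinuousLinearMap.proj (R := ℝ) (φ := fun _ : Fin 9 => ℝ) u).hasFDerivAt
  simp [pd, h.fderiv, Pi.single_apply, eq_comm]

lemma piU_eq_zero_of_le (z : ℝ) {u v : ℕ} (h : v ≤ u) (x : Fin 9 → ℝ) : piU z u v x = 0 := by
  unfold piU
  split <;> first | rfl | omega

lemma suq3Bracket_coord (z : ℝ) (u v : Fin 9) (x : Fin 9 → ℝ) :
    suq3Bracket z (fun y => y u) (fun y => y v) x = piU z u v x - piU z v u x := by
  have h : ∀ a b : Fin 9,
      (if a < b then piU z a b x *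
          (pd a (fun y => y u) x * pd b (fun y => y v) x
            - pd b (fun y => y u) x * pd a (fun y => y v) x) else 0)
        = (if a = u then if b = v then piU z a b x else 0 else 0)
          - (if a = v then if b = u then piU z a b x else 0 else 0) := by
    intro a b
    by_cases hab : a < b
    · simp only [hab, if_true, pd_coord]
      split_ifs <;> simp
    · simp [hab, piU_eq_zero_of_le z (Fin.le_def.mp (not_lt.mp hab))]
  simp [suq3Bracket, h, Finset.sum_sub_distrib]

lemma tendsto_sinh_mul_div (c : ℝ) :
    Tendsto (fun z : ℝ => Real.sinh (z * c) / z) (𝓝[≠] 0) (𝓝 c) := by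
  have h : HasDerivAt (fun z : ℝ => Real.sinh (z * c)) c 0 := by
    simpa using ((hasDerivAt_id (0 : ℝ)).mul_const c).sinh
  simpa [div_eq_inv_mul] using h.tendsto_slope_zero

lemma tendsto_nhdsNE_zero_of_continuous {f : ℝ → ℝ} {a : ℝ} (hf : Continuous f) (h : f 0 = a) :
    Tendsto f (𝓝[≠] 0) (𝓝 a) :=
  h ▸ hf.continuousAt.tendsto.mono_left nhdsWithin_le_nhds

lemma tendsto_piU (u v : Fin 9) (x : Fin 9 → ℝ) :
    Tendsto (fun z => piU z u v x) (𝓝[≠] 0) (𝓝 (lieU u v x)) := by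
  fin_cases u <;> fin_cases v <;> simp only [piU, lieU, tendsto_const_nhds, tendsto_sinh_mul_div]
  all_goals try exact tendsto_nhdsNE_zero_of_continuous (by fun_prop) (by simp)
  have h := ((tendsto_sinh_mul_div (x 0 - x 2)).add
    (tendsto_nhdsNE_zero_of_continuous (a := 0)
      (f := fun z => z * Real.sinh (z * (x 0 - x 1)) * x 5 * x 6) (by fun_prop) (by simp))).add
    (tendsto_nhdsNE_zero_of_continuous (a := 0)
      (f := fun z => z * Real.sinh (z * (x 1 - x 2)) * x 3 * x 4) (by fun_prop) (by simp))
  simpa only [add_zero] using h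

/-- in the limit z → 0 the su_q^P(3) bracket of any pair of
coordinate functions recovers the Lie–Poisson bracket of su(3). -/
theorem suq3_classical_limit :
    ∀ (u v : Fin 9) (p : Fin 9 → ℝ),
      Tendsto (fun z : ℝ => suq3Bracket z (fun x => x u) (fun x => x v) p)
        (𝓝[≠] 0) (𝓝 (lieVal u v p)) := by
  intro u v p
  simp only [suq3Bracket_coord]
  exact (tendsto_piU u v p).sub (tendsto_piU v u p)
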